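/- arXiv:1910.14634 — 2 statements merged into one kernel-verified Lean document; each statement's English description precedes it below -/
import Mathlib

section
/- For a standard Gaussian vector c ∈ ℝⁿ and nonzero vectors a, b ∈ ℝⁿ, the probability that both ⟨a, c⟩ > 0 and ⟨b, c⟩ > 0 equals (1/2)(1 − arccos(⟨a, b⟩/(‖a‖‖b‖))/π). -/
open MeasureTheory ProbabilityTheory Matrix

/-- Angular form of the standard Gaussian measure on the plane. -/
lemma gauss_prod_angular : ∃ K : ENNReal, ∀ (S : Set (ℝ × ℝ)) (T : Set ℝ), MeasurableSet S →
    MeasurableSet T →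
    (∀ r φ : ℝ, 0 < r → φ ∈ Set.Ioo (-Real.pi) Real.pi →
      ((r * Real.cos φ, r * Real.sin φ) ∈ S ↔ φ ∈ T)) →
    ((gaussianReal 0 1).prod (gaussianReal 0 1)) S
      = K * volume (T ∩ Set.Ioo (-Real.pi) Real.pi) := by
  refine ⟨∫⁻ r in Set.Ioi (0:ℝ), ENNReal.ofReal r * (gaussianPDF 0 1 r * gaussianPDF 0 1 0), ?_⟩
  intro S T hS hT h
  have hm : Measurable (gaussianPDF 0 1) := measurable_gaussianPDF 0 1
  rw [gaussianReal_of_var_ne_zero 0 one_ne_zero, prod_withDensity hm hm, withDensity_apply _ hS,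
    ← lintegral_indicator hS, ← Measure.volume_eq_prod, ← lintegral_comp_polarCoord_symm]
  have h1 : ∫⁻ p in polarCoord.target, ENNReal.ofReal p.1 •
      (S.indicator (fun z : ℝ × ℝ => gaussianPDF 0 1 z.1 * gaussianPDF 0 1 z.2)
        (polarCoord.symm p)) =
      ∫⁻ p in polarCoord.target,
        (ENNReal.ofReal p.1 * (gaussianPDF 0 1 p.1 * gaussianPDF 0 1 0)) *
          T.indicator (fun _ => 1) p.2 := by
    refine setLIntegral_congr_fun polarCoord.open_target.measurableSet ?_
    rintro ⟨r, φ⟩ ⟨hr, hφ⟩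
    have hr' : (0:ℝ) < r := hr
    have hiff := h r φ hr' hφ
    have hd : gaussianPDF 0 1 (r * Real.cos φ) * gaussianPDF 0 1 (r * Real.sin φ)
        = gaussianPDF 0 1 r * gaussianPDF 0 1 0 := by
      simp only [gaussianPDF, gaussianPDFReal]
      rw [← ENNReal.ofReal_mul (by positivity), ← ENNReal.ofReal_mul (by positivity)]
      congr 1
      have hx : ∀ k x y : ℝ, k * Real.exp x * (k * Real.exp y) = k * k * Real.exp (x + y) := by
        intro k x y; rw [Real.exp_add]; ring
      rw [hx, hx]
      congr 2
      have := Real.sin_sq_add_cos_sq φ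
      simp only [NNReal.coe_one]
      linear_combination (-(r^2) / 2) * this
    simp only [polarCoord_symm_apply, smul_eq_mul]
    by_cases hT' : φ ∈ T
    · rw [Set.indicator_of_mem (hiff.2 hT'), Set.indicator_of_mem hT', hd, mul_one]
    · rw [Set.indicator_of_notMem (fun hh => hT' (hiff.1 hh)), Set.indicator_of_notMem hT']
      simp
  rw [h1, polarCoord_target, Measure.volume_eq_prod, ← Measure.prod_restrict,
    lintegral_prod_mul (f := fun r : ℝ =>
      ENNReal.ofReal r * (gaussianPDF 0 1 r * gaussianPDF 0 1 0))
      (g := T.indicator (fun _ => (1 : ENNReal))) (by fun_prop)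
      ((measurable_const.indicator hT).aemeasurable)]
  congr 1
  rw [lintegral_indicator hT, setLIntegral_one, Measure.restrict_apply hT]

lemma gauss_prod_wedge (θ : ℝ) (h0 : 0 ≤ θ) (h1 : θ ≤ Real.pi) :
    (((gaussianReal 0 1).prod (gaussianReal 0 1))
      {p : ℝ × ℝ | 0 < p.1 ∧ 0 < Real.cos θ * p.1 + Real.sin θ * p.2}).toReal
      = (1 / 2) * (1 - θ / Real.pi) := by
  obtain ⟨K, hK⟩ := gauss_prod_angular
  have hpi := Real.pi_pos
  have htot := hK Set.univ Set.univ MeasurableSet.univ MeasurableSet.univ (by simp)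
  have hw := hK {p : ℝ × ℝ | 0 < p.1 ∧ 0 < Real.cos θ * p.1 + Real.sin θ * p.2}
    (Set.Ioo (θ - Real.pi / 2) (Real.pi / 2))
    (IsOpen.and (isOpen_lt (by fun_prop) (by fun_prop))
      (isOpen_lt (by fun_prop) (by fun_prop))).measurableSet measurableSet_Ioo (by
    rintro r φ hr ⟨hφ1, hφ2⟩
    have e : Real.cos θ * (r * Real.cos φ) + Real.sin θ * (r * Real.sin φ)
        = r * Real.cos (φ - θ) := by rw [Real.cos_sub]; ring
    simp only [Set.mem_ofPred_eq, Set.mem_Ioo, e, mul_pos_iff_of_pos_left hr]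
    constructor
    · rintro ⟨hc1, hc2⟩
      have a1 : φ < Real.pi / 2 := by
        by_contra hh
        exact absurd hc1 (not_lt.2 (Real.cos_nonpos_of_pi_div_two_le_of_le (not_lt.1 hh)
          (by linarith)))
      have a2 : -(Real.pi / 2) < φ := by
        by_contra hh
        rw [← Real.cos_neg] at hc1
        exact absurd hc1 (not_lt.2 (Real.cos_nonpos_of_pi_div_two_le_of_le (by linarith)
          (by linarith)))
      refine ⟨?_, a1⟩
      by_contra hh
      rw [← Real.cos_neg] at hc2
      exact absurd hc2 (not_lt.2 (Real.cos_nonpos_of_pi_div_two_le_of_le (by linarith)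
          (by linarith)))
    · rintro ⟨b1, b2⟩
      exact ⟨Real.cos_pos_of_mem_Ioo ⟨by linarith, b2⟩,
        Real.cos_pos_of_mem_Ioo ⟨by linarith, by linarith⟩⟩)
  rw [measure_univ, Set.univ_inter, Real.volume_Ioo] at htot
  rw [Set.inter_eq_left.2 (Set.Ioo_subset_Ioo (by linarith) (by linarith)), Real.volume_Ioo] at hw
  have htot' := congrArg ENNReal.toReal htot
  rw [ENNReal.toReal_mul, ENNReal.toReal_ofReal (by linarith), ENNReal.toReal_one] at htot'
  rw [hw, ENNReal.toReal_mul, ENNReal.toReal_ofReal (by linarith)]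
  have : K.toReal = 1 / (2 * Real.pi) := by field_simp; linarith
  rw [this]
  field_simp
  ring

lemma norm_comp_pair (L : StrongDual ℝ (ℝ × ℝ)) {G : Type*} [NormedAddCommGroup G]
    [InnerProductSpace ℝ G] (x y : G) :
    ‖L.comp ((innerSL ℝ x).prod (innerSL ℝ y))‖ = ‖L (1, 0) • x + L (0, 1) • y‖ := by
  rw [← innerSL_apply_norm ℝ (L (1, 0) • x + L (0, 1) • y)]
  congr 1
  ext z
  have : ((inner ℝ x z, inner ℝ y z) : ℝ × ℝ)
      = (inner ℝ x z : ℝ) • ((1, 0) : ℝ × ℝ) + (inner ℝ y z : ℝ) • ((0, 1) : ℝ × ℝ) := by simp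
  simp only [ContinuousLinearMap.comp_apply, ContinuousLinearMap.prod_apply,
    innerSL_apply_apply]
  rw [this, map_add, map_smul, map_smul, inner_add_left, real_inner_smul_left,
    real_inner_smul_left]
  simp [mul_comm]

lemma stdGaussian_pair_eq {E F : Type*}
    [NormedAddCommGroup E] [InnerProductSpace ℝ E] [FiniteDimensional ℝ E]
    [MeasurableSpace E] [BorelSpace E]
    [NormedAddCommGroup F] [InnerProductSpace ℝ F] [FiniteDimensional ℝ F]
    [MeasurableSpace F] [BorelSpace F]
    (u v : E) (u' v' : F) (hu : ‖u‖ = ‖u'‖) (hv : ‖v‖ = ‖v'‖)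
    (huv : inner ℝ u v = inner ℝ u' v') :
    (stdGaussian E).map ((innerSL ℝ u).prod (innerSL ℝ v)) =
      (stdGaussian F).map ((innerSL ℝ u').prod (innerSL ℝ v')) := by
  apply Measure.ext_of_charFunDual
  ext L
  rw [charFunDual_map, charFunDual_map, charFunDual_stdGaussian, charFunDual_stdGaussian,
    norm_comp_pair L u v, norm_comp_pair L u' v', ← Complex.ofReal_pow, ← Complex.ofReal_pow,
    norm_add_sq_real, norm_add_sq_real]
  simp only [norm_smul, real_inner_smul_left, real_inner_smul_right, hu, hv, huv]

lemma pi_gauss_measure {n : ℕ} (a b : Fin n → ℝ) :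
    (Measure.pi fun _ : Fin n => gaussianReal 0 1) {c : Fin n → ℝ | 0 < a ⬝ᵥ c ∧ 0 < b ⬝ᵥ c} =
    ((stdGaussian (EuclideanSpace ℝ (Fin n))).map
      ((innerSL ℝ (WithLp.toLp 2 a)).prod (innerSL ℝ (WithLp.toLp 2 b))))
      {p : ℝ × ℝ | 0 < p.1 ∧ 0 < p.2} := by
  have hS : MeasurableSet {p : ℝ × ℝ | 0 < p.1 ∧ 0 < p.2} :=
    (IsOpen.and (isOpen_lt (by fun_prop) (by fun_prop))
      (isOpen_lt (by fun_prop) (by fun_prop))).measurableSet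
  rw [Measure.map_apply (by fun_prop) hS, ← map_pi_eq_stdGaussian,
    Measure.map_apply (by fun_prop)
      ((ContinuousLinearMap.continuous _).measurable hS)]
  congr 1
  ext c
  simp [PiLp.inner_apply, dotProduct, mul_comm]

theorem stmt_10 {n : ℕ} (a b : Fin n → ℝ) (ha : a ≠ 0) (hb : b ≠ 0) :
    ((Measure.pi fun _ : Fin n => gaussianReal 0 1)
        {c : Fin n → ℝ | 0 < a ⬝ᵥ c ∧ 0 < b ⬝ᵥ c}).toReal =
      (1 / 2) * (1 - Real.arccos ((a ⬝ᵥ b) /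
        (Real.sqrt (∑ i, a i ^ 2) * Real.sqrt (∑ i, b i ^ 2))) / Real.pi) := by
  have hna : ‖WithLp.toLp 2 a‖ = Real.sqrt (∑ i, a i ^ 2) := by
    simp [EuclideanSpace.norm_eq]
  have hnb : ‖WithLp.toLp 2 b‖ = Real.sqrt (∑ i, b i ^ 2) := by
    simp [EuclideanSpace.norm_eq]
  have hin : inner ℝ (WithLp.toLp 2 a) (WithLp.toLp 2 b) = a ⬝ᵥ b := by
    simp [PiLp.inner_apply, dotProduct, mul_comm]
  rw [← hna, ← hnb, ← hin]
  have hpa : 0 < ‖WithLp.toLp 2 a‖ := by simpa using ha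
  have hpb : 0 < ‖WithLp.toLp 2 b‖ := by simpa using hb
  set A := ‖WithLp.toLp 2 a‖ with hA
  set B := ‖WithLp.toLp 2 b‖ with hB
  set ρ : ℝ := inner ℝ (WithLp.toLp 2 a) (WithLp.toLp 2 b) / (A * B) with hρ
  have hρ1 : |ρ| ≤ 1 := abs_real_inner_div_norm_mul_norm_le_one _ _
  have hcos : Real.cos (Real.arccos ρ) = ρ :=
    Real.cos_arccos (abs_le.1 hρ1).1 (abs_le.1 hρ1).2
  set θ := Real.arccos ρ with hθ
  have hcs := Real.sin_sq_add_cos_sq θ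
  rw [← gauss_prod_wedge θ (Real.arccos_nonneg _) (Real.arccos_le_pi _)]
  congr 1
  rw [pi_gauss_measure, stdGaussian_pair_eq (WithLp.toLp 2 a) (WithLp.toLp 2 b)
    (WithLp.toLp 2 ![A, 0] : EuclideanSpace ℝ (Fin 2))
    (WithLp.toLp 2 ![B * Real.cos θ, B * Real.sin θ] : EuclideanSpace ℝ (Fin 2)),
    ← pi_gauss_measure]
  · have hmp := measurePreserving_finTwoArrow (gaussianReal 0 1)
    rw [← hmp.measure_preimage_equiv]
    congr 1
    ext c
    have e : B * Real.cos θ * c 0 + B * Real.sin θ * c 1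
      = B * (Real.cos θ * c 0 + Real.sin θ * c 1) := by ring
    simp [dotProduct, Fin.sum_univ_two, e, hpa, hpb]
  · simp [EuclideanSpace.norm_eq, Fin.sum_univ_two, hpa.le, ← hA]
  · rw [← hB, EuclideanSpace.norm_eq]
    have : ∀ x y : ℝ, ∑ i, ‖(WithLp.toLp 2 ![x, y] : EuclideanSpace ℝ (Fin 2)) i‖ ^ 2
        = x ^ 2 + y ^ 2 := by intro x y; simp [Fin.sum_univ_two]
    rw [this, show (B * Real.cos θ) ^ 2 + (B * Real.sin θ) ^ 2 = B ^ 2 by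
      linear_combination B ^ 2 * hcs, Real.sqrt_sq hpb.le]
  · have : inner ℝ (WithLp.toLp 2 ![A, 0] : EuclideanSpace ℝ (Fin 2))
      (WithLp.toLp 2 ![B * Real.cos θ, B * Real.sin θ]) = A * (B * Real.cos θ) := by
      simp [PiLp.inner_apply, Fin.sum_univ_two, mul_comm]
    rw [this, hcos, hρ]
    field_simp
end

section
/- Under the assumptions of the closeness theorem (bounded spectrum α ≤ σ_n(J) ≤ σ₁(J) ≤ β and ‖J(θ)‖ ≤ β everywhere; ‖J(θ₀) − J‖ ≤ ε₀; ‖J(θ) − J(θ₀)‖ ≤ ε/2 on the ball of radius R := 2‖J† r_0‖ + (2/α²)(ε₀+ε)(1 + 2ηTβ²)‖r_0‖ around θ₀, with 1 ≤ T ≤ 1/(2ηε²) and step size η ≤ 1/β²), the nonlinear and linearized gradient descent iterates started from the same θ₀ satisfy, for all τ ≤ T: ‖r_τ − r̃_τ‖ ≤ 2(β/α²)(ε₀+ε)‖r_0‖, ‖θ_τ − θ̃_τ‖ ≤ (1/α²)(ε₀+ε)(1 + 2ητβ²)‖r_0‖, and ‖θ_τ − θ₀‖ ≤ R/2. -/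
open ContinuousLinearMap

lemma aux_sq (a b : ℝ) (hb : 0 ≤ b) (h : a ^ 2 ≤ b ^ 2) : a ≤ b :=
  (le_abs_self a).trans (abs_le_of_sq_le_sq h hb)

section Aux
variable {n N : ℕ}

lemma aux_avg (f : EuclideanSpace ℝ (Fin N) → EuclideanSpace ℝ (Fin n))
    (Jac : EuclideanSpace ℝ (Fin N) → (EuclideanSpace ℝ (Fin N) →L[ℝ] EuclideanSpace ℝ (Fin n)))
    (hf : ∀ θ, HasFDerivAt f (Jac θ) θ) (β δ : ℝ) (hJacβ : ∀ θ', ‖Jac θ'‖ ≤ β)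
    (J0 : EuclideanSpace ℝ (Fin N) →L[ℝ] EuclideanSpace ℝ (Fin n))
    (a b : EuclideanSpace ℝ (Fin N))
    (h : ∀ t : ℝ, 0 ≤ t → t ≤ 1 → ‖Jac (a + t • (b - a)) - J0‖ ≤ δ) :
    ∃ C : EuclideanSpace ℝ (Fin N) →L[ℝ] EuclideanSpace ℝ (Fin n),
      C (b - a) = f b - f a ∧ ‖C‖ ≤ β ∧ ‖C - J0‖ ≤ δ := by
  have hline : Continuous (fun t : ℝ => a + t • (b - a)) := by fun_prop
  have hmeas : MeasureTheory.StronglyMeasurable (fun t : ℝ => Jac (a + t • (b - a))) := by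
    have h1 : Jac = fderiv ℝ f := by
      funext x; exact (hf x).fderiv.symm
    rw [h1]
    have h2 : Measurable (fun t : ℝ => fderiv ℝ f (a + t • (b - a))) :=
      (measurable_fderiv ℝ f).comp hline.measurable
    have : SecondCountableTopology
        (EuclideanSpace ℝ (Fin N) →L[ℝ] EuclideanSpace ℝ (Fin n)) := by
      have : ProperSpace (EuclideanSpace ℝ (Fin N) →L[ℝ] EuclideanSpace ℝ (Fin n)) :=
        FiniteDimensional.proper ℝ _
      infer_instance
    exact h2.stronglyMeasurable
  have hint : IntervalIntegrable (fun t : ℝ => Jac (a + t • (b - a))) MeasureTheory.volume 0 1 := by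
    refine (intervalIntegrable_const (c := β)).mono_fun hmeas.aestronglyMeasurable ?_
    refine Filter.Eventually.of_forall fun t => ?_
    exact (hJacβ _).trans (le_abs_self β)
  refine ⟨∫ t in (0:ℝ)..1, Jac (a + t • (b - a)), ?_, ?_, ?_⟩
  · rw [ContinuousLinearMap.intervalIntegral_apply hint]
    have h3 := intervalIntegral.integral_eq_sub_of_hasDerivAt
      (f := fun t : ℝ => f (a + t • (b - a)))
      (f' := fun t : ℝ => Jac (a + t • (b - a)) (b - a)) (a := 0) (b := 1) ?_ ?_
    · simpa using h3
    · intro t _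
      have hd : HasDerivAt (fun t : ℝ => a + t • (b - a)) (b - a) t := by
        simpa using ((hasDerivAt_id t).smul_const (b - a)).const_add a
      exact (hf _).comp_hasDerivAt t hd
    · exact ⟨hint.1.apply_continuousLinearMap _, hint.2.apply_continuousLinearMap _⟩
  · have := intervalIntegral.norm_integral_le_of_norm_le_const (a := (0:ℝ)) (b := 1) (C := β)
      (f := fun t : ℝ => Jac (a + t • (b - a))) (fun t _ => hJacβ _)
    simpa using this
  · have h4 : (∫ t in (0:ℝ)..1, Jac (a + t • (b - a))) - J0
        = ∫ t in (0:ℝ)..1, (Jac (a + t • (b - a)) - J0) := by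
      rw [intervalIntegral.integral_sub hint intervalIntegrable_const]; simp
    rw [h4]
    have := intervalIntegral.norm_integral_le_of_norm_le_const (a := (0:ℝ)) (b := 1) (C := δ)
      (f := fun t : ℝ => Jac (a + t • (b - a)) - J0) (fun t ht => by
        rw [Set.uIoc_of_le zero_le_one] at ht
        exact h t ht.1.le ht.2)
    simpa using this

end Aux

section Aux2
variable {E F : Type*} [NormedAddCommGroup E] [InnerProductSpace ℝ E] [CompleteSpace E]
  [NormedAddCommGroup F] [InnerProductSpace ℝ F] [CompleteSpace F]

/-- A symmetric operator with `0 ≤ S ≤ c` has norm at most `c`. -/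
lemma aux_sym (S : E →L[ℝ] E) (hS : ∀ v w, inner ℝ (S v) w = inner ℝ v (S w)) (c : ℝ) (hc : 0 ≤ c)
    (h0 : ∀ v, 0 ≤ inner ℝ (S v) v) (h1 : ∀ v, inner ℝ (S v) v ≤ c * ‖v‖ ^ 2) (v : E) :
    ‖S v‖ ≤ c * ‖v‖ := by
  have key : ∀ t : ℝ, 0 ≤ inner ℝ (S v) v - 2 * t * ‖S v‖ ^ 2 + t ^ 2 * (c * ‖S v‖ ^ 2) := by
    intro t
    have h2 := h0 (v - t • S v)
    have h3 := h1 (S v)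
    have h4 : inner ℝ (S (v - t • S v)) (v - t • S v)
        = inner ℝ (S v) v - 2 * t * ‖S v‖ ^ 2 + t ^ 2 * inner ℝ (S (S v)) (S v) := by
      have h5 : inner ℝ (S (S v)) v = ‖S v‖ ^ 2 := by
        rw [hS (S v) v, real_inner_self_eq_norm_sq]
      simp only [map_sub, map_smul, inner_sub_left, inner_sub_right, real_inner_smul_left,
        real_inner_smul_right, h5, real_inner_self_eq_norm_sq]
      ring
    rw [h4] at h2
    nlinarith [mul_le_mul_of_nonneg_left h3 (sq_nonneg t)]
  have hv := h1 v
  rcases hc.eq_or_lt with rfl | hc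
  · have := key 1
    have h6 : ‖S v‖ ^ 2 ≤ 0 := by nlinarith
    have h7 : ‖S v‖ = 0 := by nlinarith [norm_nonneg (S v), sq_nonneg ‖S v‖, pow_eq_zero_iff (two_ne_zero) |>.1 (le_antisymm h6 (sq_nonneg ‖S v‖))]
    simp [h7]
  · have h8 := key (1 / c)
    have h9 : ‖S v‖ ^ 2 ≤ c * inner ℝ (S v) v := by
      have : inner ℝ (S v) v - 2 * (1 / c) * ‖S v‖ ^ 2 + (1 / c) ^ 2 * (c * ‖S v‖ ^ 2)
          = (c * inner ℝ (S v) v - ‖S v‖ ^ 2) / c := by field_simp; ring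
      rw [this] at h8
      have := mul_nonneg h8 hc.le
      rw [div_mul_cancel₀ _ hc.ne'] at this
      linarith
    apply aux_sq _ _ (by positivity)
    nlinarith

lemma aux_norm_adj (A : E →L[ℝ] F) (b : ℝ) (h : ‖A‖ ≤ b) (v : F) : ‖adjoint A v‖ ≤ b * ‖v‖ := by
  refine ContinuousLinearMap.le_of_opNorm_le _ ?_ _
  simpa using h

/-- One step of the (asymmetric) residual map. -/
lemma aux_step (C A : E →L[ℝ] F) (η β : ℝ) (hη : 0 < η) (hβ : 0 < β) (hηβ : η * β ^ 2 ≤ 1)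
    (hC : ‖C‖ ≤ β) (v : F) :
    ‖v - η • C (adjoint A v)‖ ^ 2 ≤
      ‖v‖ ^ 2 + η * ‖adjoint (C - A) v‖ ^ 2 - η * ‖adjoint C v‖ ^ 2 := by
  have h1 : ‖C (adjoint A v)‖ ^ 2 ≤ β ^ 2 * ‖adjoint A v‖ ^ 2 := by
    rw [← mul_pow]
    exact pow_le_pow_left₀ (norm_nonneg _) (C.le_of_opNorm_le hC _) 2
  have h2 : adjoint (C - A) v = adjoint C v - adjoint A v := by
    simp
  rw [h2, norm_sub_sq_real, norm_sub_sq_real, real_inner_smul_right, norm_smul, mul_pow,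
    ← adjoint_inner_left, Real.norm_eq_abs, sq_abs]
  have h3 : η ^ 2 * ‖C (adjoint A v)‖ ^ 2 ≤ η * ‖adjoint A v‖ ^ 2 := by
    calc η ^ 2 * ‖C (adjoint A v)‖ ^ 2 ≤ η ^ 2 * (β ^ 2 * ‖adjoint A v‖ ^ 2) := by gcongr
      _ = η * ((η * β ^ 2) * ‖adjoint A v‖ ^ 2) := by ring
      _ ≤ η * (1 * ‖adjoint A v‖ ^ 2) := by gcongr
      _ = _ := by ring
  nlinarith

lemma aux_S (J : E →L[ℝ] F) (α β η : ℝ) (hα : 0 < α) (hη : 0 < η)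
    (hηβ : η * β ^ 2 ≤ 1) (hJβ : ‖J‖ ≤ β) (hαβ : α ≤ β)
    (hJα : ∀ z, α * ‖z‖ ≤ ‖adjoint J z‖) (v : F) :
    ‖v - η • J (adjoint J v)‖ ≤ (1 - η * α ^ 2) * ‖v‖ := by
  have hq : 0 ≤ 1 - η * α ^ 2 := by
    have : η * α ^ 2 ≤ η * β ^ 2 := by gcongr
    linarith
  have hi : ∀ v : F, inner ℝ (v - η • J (adjoint J v)) v = ‖v‖ ^ 2 - η * ‖adjoint J v‖ ^ 2 := by
    intro v
    rw [inner_sub_left, real_inner_smul_left, real_inner_self_eq_norm_sq, ← adjoint_inner_right,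
      real_inner_self_eq_norm_sq]
  have := aux_sym (ContinuousLinearMap.id ℝ F - η • (J ∘L adjoint J)) ?_ (1 - η * α ^ 2) hq ?_ ?_ v
  · simpa using this
  · intro v w
    simp only [sub_apply, smul_apply, comp_apply, coe_id', id_eq, inner_sub_left,
      inner_sub_right, real_inner_smul_left, real_inner_smul_right]
    rw [← adjoint_inner_right, ← adjoint_inner_left J]
  · intro v
    have h := hi v
    simp only [sub_apply, smul_apply, comp_apply, coe_id', id_eq]
    rw [h]
    have h2 := aux_norm_adj J β hJβ v
    have h3 : ‖adjoint J v‖ ^ 2 ≤ (β * ‖v‖) ^ 2 := pow_le_pow_left₀ (norm_nonneg _) h2 2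
    nlinarith [mul_le_mul_of_nonneg_left h3 hη.le, sq_nonneg ‖v‖]
  · intro v
    have h := hi v
    simp only [sub_apply, smul_apply, comp_apply, coe_id', id_eq]
    rw [h]
    have h3 : (α * ‖v‖) ^ 2 ≤ ‖adjoint J v‖ ^ 2 := pow_le_pow_left₀ (by positivity) (hJα v) 2
    nlinarith [mul_le_mul_of_nonneg_left h3 hη.le]

/-- Powers of `P = I - η JᵀJ`. -/
lemma aux_P (J : E →L[ℝ] F) (β η : ℝ) (hη : 0 < η) (hηβ : η * β ^ 2 ≤ 1) (hJβ : ‖J‖ ≤ β)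
    (w : ℕ → E) (hw : ∀ k, w (k + 1) = w k - η • adjoint J (J (w k))) (k : ℕ) :
    ‖w k‖ ≤ ‖w 0‖ ∧ ‖w k - w 0‖ ≤ ‖w 0‖ := by
  set P : E →L[ℝ] E := ContinuousLinearMap.id ℝ E - η • (adjoint J ∘L J) with hP
  have hPs : ∀ v w, inner ℝ (P v) w = inner ℝ v (P w) := by
    intro v w
    simp [hP, inner_sub_left, inner_sub_right, real_inner_smul_left, real_inner_smul_right,
      adjoint_inner_left, adjoint_inner_right]
  have hi : ∀ v : E, inner ℝ (P v) v = ‖v‖ ^ 2 - η * ‖J v‖ ^ 2 := by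
    intro v
    simp [hP, inner_sub_left, real_inner_smul_left, adjoint_inner_left]
  have hP0 : ∀ v, 0 ≤ inner ℝ (P v) v := by
    intro v
    rw [hi]
    have h3 : ‖J v‖ ^ 2 ≤ (β * ‖v‖) ^ 2 :=
      pow_le_pow_left₀ (norm_nonneg _) (J.le_of_opNorm_le hJβ v) 2
    nlinarith [mul_le_mul_of_nonneg_left h3 hη.le, sq_nonneg ‖v‖]
  have hP1 : ∀ v, ‖P v‖ ≤ ‖v‖ := by
    intro v
    have := aux_sym P hPs 1 zero_le_one hP0 (fun v => by
      rw [hi]; nlinarith [mul_nonneg hη.le (sq_nonneg ‖J v‖)]) v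
    simpa using this
  have hpn : ∀ k v, ‖(P ^ k) v‖ ≤ ‖v‖ := by
    intro k
    induction k with
    | zero => intro v; simp
    | succ k ih => intro v; rw [pow_succ]; exact (ih (P v)).trans (hP1 v)
  have hps : ∀ k v w, inner ℝ ((P ^ k) v) w = inner ℝ v ((P ^ k) w) := by
    intro k
    induction k with
    | zero => intro v w; simp
    | succ k ih =>
      intro v w
      have h1 : (P ^ (k + 1)) v = (P ^ k) (P v) := by rw [pow_succ]; rfl
      have h2 : (P ^ (k + 1)) w = P ((P ^ k) w) := by rw [pow_succ']; rfl
      rw [h1, h2, ih, hPs]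
  have hp0 : ∀ k v, 0 ≤ inner ℝ ((P ^ k) v) v := by
    intro k v
    rcases Nat.even_or_odd' k with ⟨m, rfl | rfl⟩
    · have h1 : (P ^ (2 * m)) v = (P ^ m) ((P ^ m) v) := by rw [two_mul, pow_add]; rfl
      rw [h1, hps]; exact real_inner_self_nonneg
    · have h1 : (P ^ (2 * m + 1)) v = (P ^ m) (P ((P ^ m) v)) := by
        rw [show 2 * m + 1 = m + 1 + m by ring, pow_add, pow_succ]; rfl
      rw [h1, hps]; exact hP0 _
  have hwk : ∀ k, w k = (P ^ k) (w 0) := by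
    intro k
    induction k with
    | zero => simp
    | succ k ih =>
      have h1 : (P ^ (k + 1)) (w 0) = P ((P ^ k) (w 0)) := by rw [pow_succ']; rfl
      rw [h1, ← ih, hw]; simp [hP]
  refine ⟨by rw [hwk k]; exact hpn k _, ?_⟩
  have := aux_sym (ContinuousLinearMap.id ℝ E - P ^ k) ?_ 1 zero_le_one ?_ ?_ (w 0)
  · rw [hwk k, norm_sub_rev]; simpa using this
  · intro v w
    simp only [sub_apply, coe_id', id_eq, inner_sub_left, inner_sub_right, hps]
  · intro v
    simp only [sub_apply, coe_id', id_eq, inner_sub_left, real_inner_self_eq_norm_sq]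
    have := real_inner_le_norm ((P ^ k) v) v
    nlinarith [hpn k v, norm_nonneg v]
  · intro v
    simp only [sub_apply, coe_id', id_eq, inner_sub_left, real_inner_self_eq_norm_sq]
    linarith [hp0 k v]

end Aux2

lemma aux_G (T : ℕ) (η ε : ℝ) (hη : 0 < η) (hε : 0 < ε)
    (hT2 : (T : ℝ) ≤ 1 / (2 * η * ε ^ 2)) (k : ℕ) (hk : k ≤ T) :
    (Real.sqrt (1 + η * ε ^ 2)) ^ k ≤ 1.3 := by
  have hx : 0 < η * ε ^ 2 := by positivity
  have h1 : (T : ℝ) * (η * ε ^ 2) ≤ 1 / 2 := by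
    rw [le_div_iff₀ (by positivity)] at hT2
    linarith
  have h2 : (k : ℝ) * (η * ε ^ 2) ≤ 1 / 2 :=
    le_trans (by gcongr) h1
  have h3 : (1 + η * ε ^ 2) ^ k ≤ Real.exp (1 / 2) := by
    calc (1 + η * ε ^ 2) ^ k ≤ (Real.exp (η * ε ^ 2)) ^ k := by
          gcongr; linarith [Real.add_one_le_exp (η * ε ^ 2)]
      _ = Real.exp (k * (η * ε ^ 2)) := by rw [← Real.exp_nat_mul]
      _ ≤ _ := Real.exp_le_exp.2 h2
  have h4 : Real.exp (1 / 2) ≤ 1.69 := by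
    apply aux_sq _ _ (by norm_num)
    rw [← Real.exp_nat_mul]
    norm_num
    linarith [Real.exp_one_lt_d9]
  apply aux_sq _ _ (by norm_num)
  rw [← pow_mul, mul_comm k 2, pow_mul, Real.sq_sqrt (by positivity)]
  norm_num at h4 ⊢
  linarith

/-- The scalar argument that turns the two residual estimates into the final bound. -/
lemma aux_final (α β ε₀ ε r e g p : ℝ) (hα : 0 < α) (hβ : 0 < β) (hε₀ : 0 ≤ ε₀) (hε : 0 < ε)
    (hαβ : α ≤ β) (hr : 0 ≤ r) (hg1 : 1 ≤ g) (hg : g ≤ 1.3) (hp : 0 ≤ p)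
    (hcase : g = 1 ∨ α < ε₀ + 1.5 * ε)
    (hA : e ≤ β / α ^ 2 * (2 * ε₀ + ε) * r * (g - p)) (hB : e ≤ (g + p) * r) :
    e ≤ 2 * (β / α ^ 2) * (ε₀ + ε) * r := by
  have hK : 0 ≤ β / α ^ 2 * r := by positivity
  have hA' : e ≤ β / α ^ 2 * r * ((2 * ε₀ + ε) * (g - p)) := by linarith
  suffices h : (2 * ε₀ + ε) * (g - p) ≤ 2 * (ε₀ + ε) ∨ (g + p) * r ≤ β / α ^ 2 * r * (2 * (ε₀ + ε)) by
    rcases h with h | h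
    · have := mul_le_mul_of_nonneg_left h hK; linarith
    · linarith
  by_cases h1 : g - p ≤ 1
  · left; nlinarith
  push Not at h1
  rcases hcase with rfl | hc
  · exfalso; linarith
  by_cases h2 : ε₀ ≤ ε
  · left; nlinarith
  push Not at h2
  right
  have h3 : 1 / α ≤ β / α ^ 2 := by
    rw [div_le_div_iff₀ hα (by positivity)]; nlinarith
  have h4 : 1.6 ≤ 1 / α * (2 * (ε₀ + ε)) := by
    rw [div_mul_eq_mul_div, le_div_iff₀ hα]; nlinarith
  have h5 : g + p ≤ β / α ^ 2 * (2 * (ε₀ + ε)) := by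
    have : 1 / α * (2 * (ε₀ + ε)) ≤ β / α ^ 2 * (2 * (ε₀ + ε)) := by gcongr
    linarith
  nlinarith [mul_le_mul_of_nonneg_right h5 hr]

set_option maxHeartbeats 4000000 in
/-- Theorem (closeness of the linear and nonlinear least-squares problems): under the
bounded-spectrum, initialization-closeness and bounded-variation assumptions, with radius
`R = 2‖J† r₀‖ + (2/α²)(ε₀+ε)(1+2ηTβ²)‖r₀‖`, `1 ≤ T ≤ 1/(2ηε²)` and step size `η ≤ 1/β²`,
for all `τ ≤ T` the nonlinear and linearized iterates and residuals obey
`‖r_τ - r̃_τ‖ ≤ 2(β/α²)(ε₀+ε)‖r₀‖`, `‖θ_τ - θ̃_τ‖ ≤ (1/α²)(ε₀+ε)(1+2ητβ²)‖r₀‖`,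
and `‖θ_τ - θ₀‖ ≤ R/2`. -/
theorem stmt_13 {n N : ℕ}
    (f : EuclideanSpace ℝ (Fin N) → EuclideanSpace ℝ (Fin n))
    (Jac : EuclideanSpace ℝ (Fin N) → (EuclideanSpace ℝ (Fin N) →L[ℝ] EuclideanSpace ℝ (Fin n)))
    (hf : ∀ θ, HasFDerivAt f (Jac θ) θ)
    (J : EuclideanSpace ℝ (Fin N) →L[ℝ] EuclideanSpace ℝ (Fin n))
    (Jdag : EuclideanSpace ℝ (Fin n) →L[ℝ] EuclideanSpace ℝ (Fin N))
    (hdag1 : ∀ z, J (Jdag z) = z)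
    (hdag2 : Jdag ∘L J = ContinuousLinearMap.adjoint (Jdag ∘L J))
    (α β ε₀ ε η : ℝ) (hα : 0 < α) (hβ : 0 < β) (hε₀ : 0 ≤ ε₀) (hε : 0 < ε)
    (hJacβ : ∀ θ', ‖Jac θ'‖ ≤ β)
    (hJβ : ‖J‖ ≤ β)
    (hJα : ∀ z, α * ‖z‖ ≤ ‖(ContinuousLinearMap.adjoint J) z‖)
    (y : EuclideanSpace ℝ (Fin n))
    (T : ℕ) (hT1 : 1 ≤ T) (hT2 : (T : ℝ) ≤ 1 / (2 * η * ε ^ 2))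
    (hη : 0 < η) (hηβ : η ≤ 1 / β ^ 2)
    (θ θtil : ℕ → EuclideanSpace ℝ (Fin N))
    (hinit : θtil 0 = θ 0)
    (hstep : ∀ τ : ℕ,
      θ (τ + 1) = θ τ - η • (ContinuousLinearMap.adjoint (Jac (θ τ))) (f (θ τ) - y))
    (hsteplin : ∀ τ : ℕ,
      θtil (τ + 1) = θtil τ -
        η • (ContinuousLinearMap.adjoint J) (f (θ 0) + J (θtil τ - θ 0) - y))
    (hclose0 : ‖Jac (θ 0) - J‖ ≤ ε₀)
    (hvar : ∀ θ',
      ‖θ' - θ 0‖ ≤ 2 * ‖Jdag (f (θ 0) - y)‖ +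
          2 / α ^ 2 * (ε₀ + ε) * (1 + 2 * η * T * β ^ 2) * ‖f (θ 0) - y‖ →
        ‖Jac θ' - Jac (θ 0)‖ ≤ ε / 2) :
    ∀ τ : ℕ, τ ≤ T →
      (‖(f (θ τ) - y) -
          ((ContinuousLinearMap.id ℝ (EuclideanSpace ℝ (Fin n)) -
            η • (J ∘L ContinuousLinearMap.adjoint J)) ^ τ) (f (θ 0) - y)‖ ≤
        2 * (β / α ^ 2) * (ε₀ + ε) * ‖f (θ 0) - y‖) ∧
      (‖θ τ - θtil τ‖ ≤
        1 / α ^ 2 * (ε₀ + ε) * (1 + 2 * η * τ * β ^ 2) * ‖f (θ 0) - y‖) ∧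
      (‖θ τ - θ 0‖ ≤
        (2 * ‖Jdag (f (θ 0) - y)‖ +
          2 / α ^ 2 * (ε₀ + ε) * (1 + 2 * η * T * β ^ 2) * ‖f (θ 0) - y‖) / 2) := by
  by_cases hr0 : f (θ 0) - y = 0
  · have hθ : ∀ τ, θ τ = θ 0 := by
      intro τ
      induction τ with
      | zero => rfl
      | succ k ih => rw [hstep, ih, hr0]; simp
    have hθt : ∀ τ, θtil τ = θ 0 := by
      intro τ
      induction τ with
      | zero => exact hinit
      | succ k ih => rw [hsteplin, ih]; simp [hr0]
    intro τ _
    rw [hθ, hθt, hr0, map_zero]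
    simp
  have hηβ' : η * β ^ 2 ≤ 1 := by
    rwa [le_div_iff₀ (by positivity)] at hηβ
  have hrpos : 0 < ‖f (θ 0) - y‖ := norm_pos_iff.2 hr0
  have hαβ : α ≤ β := by
    have h1 := (hJα (f (θ 0) - y)).trans (aux_norm_adj J β hJβ _)
    exact le_of_mul_le_mul_right h1 hrpos
  have hαη : η * α ^ 2 ≤ 1 := le_trans (by gcongr) hηβ'
  set w : ℕ → EuclideanSpace ℝ (Fin N) := fun k => Jdag (f (θ 0) - y) + (θtil k - θ 0) with hwdef
  have hJw : ∀ k, J (w k) = f (θ 0) + J (θtil k - θ 0) - y := by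
    intro k
    simp only [hwdef, map_add, hdag1]
    abel
  have hw : ∀ k, w (k + 1) = w k - η • adjoint J (J (w k)) := by
    intro k
    rw [hJw k]
    simp only [hwdef]
    rw [hsteplin k]
    abel
  have hw0 : w 0 = Jdag (f (θ 0) - y) := by simp [hwdef, hinit]
  have hP := aux_P J β η hη hηβ' hJβ w hw
  set S : EuclideanSpace ℝ (Fin n) →L[ℝ] EuclideanSpace ℝ (Fin n) :=
    ContinuousLinearMap.id ℝ (EuclideanSpace ℝ (Fin n)) -
            η • (J ∘L ContinuousLinearMap.adjoint J) with hSdef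
  have hSapp : ∀ v, S v = v - η • J (adjoint J v) := by intro v; simp [hSdef]
  have hSpow : ∀ k, (S ^ k) (f (θ 0) - y) = J (w k) := by
    intro k
    induction k with
    | zero => rw [hw0, hdag1]; simp
    | succ k ih =>
      have h1 : (S ^ (k + 1)) (f (θ 0) - y) = S ((S ^ k) (f (θ 0) - y)) := by
        rw [pow_succ']; rfl
      rw [h1, ih, hSapp, hw]
      simp
  obtain ⟨q, hq⟩ : ∃ q, q = 1 - η * α ^ 2 := ⟨_, rfl⟩
  have hq0 : 0 ≤ q := by linarith
  have hq1 : q ≤ 1 := by rw [hq]; nlinarith [mul_pos hη (pow_pos hα 2)]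
  obtain ⟨r, hr⟩ : ∃ r, r = ‖f (θ 0) - y‖ := ⟨_, rfl⟩
  have hrt : ∀ k, ‖J (w k)‖ ≤ q ^ k * r := by
    intro k
    induction k with
    | zero => rw [hw0, hdag1, hr]; simp
    | succ k ih =>
      have h1 : J (w (k + 1)) = J (w k) - η • J (adjoint J (J (w k))) := by
        rw [hw k]; simp
      rw [h1]
      refine (aux_S J α β η hα hη hηβ' hJβ hαβ hJα _).trans ?_
      rw [← hq, pow_succ', mul_assoc]
      gcongr
  obtain ⟨G, hG1, hGT, hGcase, hGstep⟩ : ∃ G : ℝ, 1 ≤ G ∧ (∀ k, k ≤ T → G ^ k ≤ 1.3) ∧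
      (G = 1 ∨ α < ε₀ + 1.5 * ε) ∧
      (∀ C A : EuclideanSpace ℝ (Fin N) →L[ℝ] EuclideanSpace ℝ (Fin n), ‖C‖ ≤ β →
        ‖C - J‖ ≤ ε₀ + ε / 2 → ‖C - A‖ ≤ ε →
        ∀ v, ‖v - η • C (adjoint A v)‖ ≤ G * ‖v‖) := by
    by_cases hc : α < ε₀ + 1.5 * ε
    · refine ⟨Real.sqrt (1 + η * ε ^ 2), ?_, aux_G T η ε hη hε hT2, Or.inr hc, ?_⟩
      · rw [Real.one_le_sqrt]; nlinarith [mul_pos hη (pow_pos hε 2)]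
      · intro C A hC _ hCA v
        have h1 := aux_step C A η β hη hβ hηβ' hC v
        have h2 : ‖adjoint (C - A) v‖ ^ 2 ≤ (ε * ‖v‖) ^ 2 :=
          pow_le_pow_left₀ (norm_nonneg _) (aux_norm_adj _ _ hCA v) 2
        apply aux_sq _ _ (by positivity)
        rw [mul_pow, Real.sq_sqrt (by positivity)]
        nlinarith [mul_le_mul_of_nonneg_left h2 hη.le,
          mul_nonneg hη.le (sq_nonneg ‖adjoint C v‖)]
    · push Not at hc
      refine ⟨1, le_refl _, fun k _ => by norm_num, Or.inl rfl, ?_⟩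
      intro C A hC hCJ hCA v
      have h1 := aux_step C A η β hη hβ hηβ' hC v
      have h2 := aux_norm_adj _ _ hCA v
      have h3 := aux_norm_adj _ _ hCJ v
      have h4 : ‖adjoint J v‖ ≤ ‖adjoint C v‖ + ‖adjoint (C - J) v‖ := by
        have : adjoint J v = adjoint C v - adjoint (C - J) v := by simp
        rw [this]; exact norm_sub_le _ _
      have h5 := hJα v
      have h6 : ε * ‖v‖ ≤ ‖adjoint C v‖ := by
        have h8 := mul_le_mul_of_nonneg_right hc (norm_nonneg v)
        linarith
      have h7 : ‖adjoint (C - A) v‖ ^ 2 ≤ ‖adjoint C v‖ ^ 2 :=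
        pow_le_pow_left₀ (norm_nonneg _) (h2.trans h6) 2
      apply aux_sq _ _ (by positivity)
      have h9 := mul_le_mul_of_nonneg_left h7 hη.le
      rw [one_mul]
      linarith
  simp only [hSpow]
  rw [← hr] at hvar hrpos ⊢
  rw [← hw0] at hvar ⊢
  have hb : 0 < β / α ^ 2 := by positivity
  have hcons : ∀ τ : ℕ, τ ≤ T →
      ‖(f (θ τ) - y) - J (w τ)‖ ≤ β / α ^ 2 * (2 * ε₀ + ε) * r * (G ^ τ - q ^ τ) →
      ‖f (θ τ) - y‖ ≤ G ^ τ * r →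
      ‖θ τ - θtil τ‖ ≤ 1 / α ^ 2 * (ε₀ + ε) * ((1 - q ^ τ) + 2 * η * τ * β ^ 2) * r →
      (‖(f (θ τ) - y) - J (w τ)‖ ≤ 2 * (β / α ^ 2) * (ε₀ + ε) * r) ∧
      (‖θ τ - θtil τ‖ ≤ 1 / α ^ 2 * (ε₀ + ε) * (1 + 2 * η * τ * β ^ 2) * r) ∧
      (‖θ τ - θ 0‖ ≤ (2 * ‖w 0‖ +
          2 / α ^ 2 * (ε₀ + ε) * (1 + 2 * η * T * β ^ 2) * r) / 2) := by
    intro τ hτ h1 h2 h3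
    have hqτ : 0 ≤ q ^ τ := by positivity
    have h4 : ‖θ τ - θtil τ‖ ≤ 1 / α ^ 2 * (ε₀ + ε) * (1 + 2 * η * τ * β ^ 2) * r := by
      refine h3.trans ?_
      gcongr
      linarith
    refine ⟨?_, h4, ?_⟩
    · refine aux_final α β ε₀ ε r _ (G ^ τ) (q ^ τ) hα hβ hε₀ hε hαβ hrpos.le
        (one_le_pow₀ hG1) (hGT τ hτ) hqτ ?_ h1 ?_
      · rcases hGcase with h | h
        · left; rw [h, one_pow]
        · exact Or.inr h
      · refine (norm_sub_le _ _).trans ?_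
        linarith [hrt τ]
    · have h5 : ‖θtil τ - θ 0‖ ≤ ‖w 0‖ := by
        have : θtil τ - θ 0 = w τ - w 0 := by rw [hw0]; simp [hwdef]
        rw [this]; exact (hP τ).2
      have h6 : ‖θ τ - θ 0‖ ≤ ‖θ τ - θtil τ‖ + ‖θtil τ - θ 0‖ := norm_sub_le_norm_sub_add_norm_sub _ _ _
      have h7 : 1 / α ^ 2 * (ε₀ + ε) * (1 + 2 * η * τ * β ^ 2) * r ≤
          1 / α ^ 2 * (ε₀ + ε) * (1 + 2 * η * T * β ^ 2) * r := by gcongr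
      have h8 : 2 / α ^ 2 * (ε₀ + ε) * (1 + 2 * η * T * β ^ 2) * r =
          2 * (1 / α ^ 2 * (ε₀ + ε) * (1 + 2 * η * T * β ^ 2) * r) := by ring
      rw [h8]
      linarith
  suffices hinv : ∀ τ : ℕ, τ ≤ T →
      ‖(f (θ τ) - y) - J (w τ)‖ ≤ β / α ^ 2 * (2 * ε₀ + ε) * r * (G ^ τ - q ^ τ) ∧
      ‖f (θ τ) - y‖ ≤ G ^ τ * r ∧
      ‖θ τ - θtil τ‖ ≤ 1 / α ^ 2 * (ε₀ + ε) * ((1 - q ^ τ) + 2 * η * τ * β ^ 2) * r by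
    intro τ hτ
    obtain ⟨h1, h2, h3⟩ := hinv τ hτ
    exact hcons τ hτ h1 h2 h3
  intro τ
  induction τ with
  | zero =>
    intro _
    refine ⟨?_, ?_, ?_⟩
    · rw [hw0, hdag1]; simp
    · rw [hr]; simp
    · simp [hinit]
  | succ k ih =>
    intro hk
    obtain ⟨i1, i2, i3⟩ := ih (by omega)
    obtain ⟨c1, c2, c3⟩ := hcons k (by omega) i1 i2 i3
    have hqk : 0 ≤ q ^ k := by positivity
    have hqk1 : q ^ k ≤ 1 := pow_le_one₀ hq0 hq1
    set R2 : ℝ := 1 / α ^ 2 * (ε₀ + ε) * (1 + 2 * η * T * β ^ 2) * r with hR2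
    have hR : 2 * ‖w 0‖ + 2 / α ^ 2 * (ε₀ + ε) * (1 + 2 * η * T * β ^ 2) * r =
        2 * (‖w 0‖ + R2) := by rw [hR2]; ring
    rw [hR] at hvar c3
    have hR2nn : 0 ≤ R2 := by positivity
    have c3' : ‖θ k - θ 0‖ ≤ ‖w 0‖ + R2 := by linarith
    have hJk0 : ‖Jac (θ k) - Jac (θ 0)‖ ≤ ε / 2 :=
      hvar _ (by linarith [norm_nonneg (w 0)])
    have hJkJ : ‖Jac (θ k) - J‖ ≤ ε₀ + ε / 2 := by
      have := norm_sub_le_norm_sub_add_norm_sub (Jac (θ k)) (Jac (θ 0)) J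
      linarith
    have hgd : ‖adjoint (Jac (θ k)) (f (θ k) - y) - adjoint J (J (w k))‖ ≤
        (ε₀ + ε / 2) * (q ^ k * r) + β * (2 * (β / α ^ 2) * (ε₀ + ε) * r) := by
      have h1 : adjoint (Jac (θ k)) (f (θ k) - y) - adjoint J (J (w k)) =
          adjoint (Jac (θ k) - J) (J (w k)) + adjoint (Jac (θ k)) ((f (θ k) - y) - J (w k)) := by
        rw [map_sub adjoint, map_sub (adjoint (Jac (θ k))) (f (θ k) - y), sub_apply]
        abel
      rw [h1]
      refine (norm_add_le _ _).trans (add_le_add ?_ ?_)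
      · refine (aux_norm_adj _ _ hJkJ _).trans ?_
        gcongr
        exact hrt k
      · refine (aux_norm_adj _ _ (hJacβ _) _).trans ?_
        gcongr
    have hstepn : ‖θ (k + 1) - θ k‖ ≤ ‖w 0‖ + R2 := by
      have h1 : θ (k + 1) - θ k = - (η • (adjoint (Jac (θ k)) (f (θ k) - y) - adjoint J (J (w k)))
          + η • adjoint J (J (w k))) := by
        rw [hstep k, smul_sub]; abel
      rw [h1, norm_neg]
      refine (norm_add_le _ _).trans ?_
      rw [norm_smul, norm_smul, Real.norm_eq_abs, abs_of_pos hη]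
      have h2 : η * ‖adjoint J (J (w k))‖ ≤ ‖w 0‖ := by
        calc η * ‖adjoint J (J (w k))‖ ≤ η * (β * (β * ‖w k‖)) := by
              gcongr
              refine (aux_norm_adj _ _ hJβ _).trans ?_
              gcongr
              exact J.le_of_opNorm_le hJβ _
          _ = (η * β ^ 2) * ‖w k‖ := by ring
          _ ≤ 1 * ‖w 0‖ := by gcongr; exact (hP k).1
          _ = _ := one_mul _
      have h3 : η * ‖adjoint (Jac (θ k)) (f (θ k) - y) - adjoint J (J (w k))‖ ≤ R2 := by
        have hη2 : η ≤ 1 / α ^ 2 := by rw [le_div_iff₀ (by positivity)]; exact hαη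
        have hT1' : (1 : ℝ) ≤ T := by exact_mod_cast hT1
        calc _ ≤ η * ((ε₀ + ε / 2) * (q ^ k * r) + β * (2 * (β / α ^ 2) * (ε₀ + ε) * r)) := by
              gcongr
          _ = η * ((ε₀ + ε / 2) * (q ^ k * r)) +
              1 / α ^ 2 * (ε₀ + ε) * (2 * η * 1 * β ^ 2) * r := by ring
          _ ≤ 1 / α ^ 2 * ((ε₀ + ε) * (1 * r)) +
              1 / α ^ 2 * (ε₀ + ε) * (2 * η * T * β ^ 2) * r := by
              gcongr
              linarith
          _ = R2 := by rw [hR2]; ring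
      linarith
    obtain ⟨C, hC, hCβ, hC0⟩ := aux_avg f Jac hf β (ε / 2) hJacβ (Jac (θ 0)) (θ k) (θ (k + 1))
      (by
        intro t ht0 ht1
        apply hvar
        have h1 : θ k + t • (θ (k + 1) - θ k) - θ 0 = (θ k - θ 0) + t • (θ (k + 1) - θ k) := by
          abel
        rw [h1]
        refine (norm_add_le _ _).trans ?_
        rw [norm_smul, Real.norm_eq_abs, abs_of_nonneg ht0]
        nlinarith [norm_nonneg (θ (k + 1) - θ k)])
    have hCJ : ‖C - J‖ ≤ ε₀ + ε / 2 := by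
      have := norm_sub_le_norm_sub_add_norm_sub C (Jac (θ 0)) J
      linarith
    have hCA : ‖C - Jac (θ k)‖ ≤ ε := by
      have := norm_sub_le_norm_sub_add_norm_sub C (Jac (θ 0)) (Jac (θ k))
      rw [norm_sub_rev (Jac (θ 0))] at this
      linarith
    have hG := hGstep C (Jac (θ k)) hCβ hCJ hCA
    have hres : f (θ (k + 1)) - y =
        (f (θ k) - y) - η • C (adjoint (Jac (θ k)) (f (θ k) - y)) := by
      have h1 : θ (k + 1) - θ k = - (η • adjoint (Jac (θ k)) (f (θ k) - y)) := by
        rw [hstep k]; abel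
      rw [h1, map_neg, map_smul] at hC
      have h2 : f (θ (k + 1)) - y = (f (θ k) - y) + (f (θ (k + 1)) - f (θ k)) := by abel
      rw [h2, ← hC]; abel
    have hJwk : J (w (k + 1)) = J (w k) - η • J (adjoint J (J (w k))) := by
      rw [hw k]; simp
    refine ⟨?_, ?_, ?_⟩
    · have h1 : f (θ (k + 1)) - y - J (w (k + 1)) =
          (((f (θ k) - y) - J (w k)) - η • C (adjoint (Jac (θ k)) ((f (θ k) - y) - J (w k)))) -
          η • (C (adjoint (Jac (θ k) - J) (J (w k))) + (C - J) (adjoint J (J (w k)))) := by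
        rw [hres, hJwk, map_sub adjoint, sub_apply, sub_apply,
          map_sub (adjoint (Jac (θ k))) (f (θ k) - y) (J (w k)), map_sub C, map_sub C]
        module
      rw [h1]
      refine (norm_sub_le _ _).trans ?_
      have h2 := hG ((f (θ k) - y) - J (w k))
      have h3 : ‖C (adjoint (Jac (θ k) - J) (J (w k))) + (C - J) (adjoint J (J (w k)))‖ ≤
          β * ((ε₀ + ε / 2) * (q ^ k * r)) + (ε₀ + ε / 2) * (β * (q ^ k * r)) := by
        refine (norm_add_le _ _).trans (add_le_add ?_ ?_)
        · refine (C.le_of_opNorm_le hCβ _).trans ?_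
          gcongr
          refine (aux_norm_adj _ _ hJkJ _).trans ?_
          gcongr
          exact hrt k
        · refine ((C - J).le_of_opNorm_le hCJ _).trans ?_
          gcongr
          refine (aux_norm_adj _ _ hJβ _).trans ?_
          gcongr
          exact hrt k
      rw [norm_smul, Real.norm_eq_abs, abs_of_pos hη]
      set K : ℝ := β / α ^ 2 * (2 * ε₀ + ε) * r with hKdef
      have hK0 : 0 ≤ K := by positivity
      have h4 : η * (β * ((ε₀ + ε / 2) * (q ^ k * r)) + (ε₀ + ε / 2) * (β * (q ^ k * r))) =
          K * ((1 - q) * q ^ k) := by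
        rw [hKdef, hq]; field_simp; ring
      have h5 := mul_le_mul_of_nonneg_left h3 hη.le
      rw [h4] at h5
      have h6 : G * ‖(f (θ k) - y) - J (w k)‖ ≤ G * (K * (G ^ k - q ^ k)) := by gcongr
      have h7 : G * (K * (G ^ k - q ^ k)) + K * ((1 - q) * q ^ k) ≤
          K * (G ^ (k + 1) - q ^ (k + 1)) := by
        rw [pow_succ, pow_succ]
        nlinarith [mul_nonneg (mul_nonneg hK0 hqk) (sub_nonneg.2 hG1)]
      linarith
    · rw [hres]
      refine (hG _).trans ?_
      rw [pow_succ', mul_assoc]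
      gcongr
    · have h1 : θ (k + 1) - θtil (k + 1) = (θ k - θtil k) -
          η • (adjoint (Jac (θ k)) (f (θ k) - y) - adjoint J (J (w k))) := by
        rw [hstep k, hsteplin k, ← hJw k, smul_sub]; abel
      rw [h1]
      refine (norm_sub_le _ _).trans ?_
      rw [norm_smul, Real.norm_eq_abs, abs_of_pos hη]
      have h2 := mul_le_mul_of_nonneg_left hgd hη.le
      have h3 : η * ((ε₀ + ε / 2) * (q ^ k * r) + β * (2 * (β / α ^ 2) * (ε₀ + ε) * r)) ≤
          η * ((ε₀ + ε) * (q ^ k * r) + β * (2 * (β / α ^ 2) * (ε₀ + ε) * r)) := by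
        gcongr
        linarith
      have h4 : 1 / α ^ 2 * (ε₀ + ε) * ((1 - q ^ (k + 1)) + 2 * η * ((k + 1 : ℕ) : ℝ) * β ^ 2) * r =
          1 / α ^ 2 * (ε₀ + ε) * ((1 - q ^ k) + 2 * η * k * β ^ 2) * r +
          η * ((ε₀ + ε) * (q ^ k * r) + β * (2 * (β / α ^ 2) * (ε₀ + ε) * r)) := by
        have h5 : q ^ (k + 1) = q ^ k - η * α ^ 2 * q ^ k := by rw [pow_succ, hq]; ring
        rw [h5]; push_cast; field_simp; ring
      rw [h4]
      linarith
end
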